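/- Let p, q be probability vectors on Fin d, and let e₀ be the probability vector on Fin 2 with e₀ 0 = 1 and e₀ 1 = 0. Then the following are equivalent: (1) for every ε > 0 there exist probability vectors p' on Fin d and e on Fin 2 with ∑_{(i,j)}, |(p' ⊗ e) (i,j) − (p ⊗ e₀) (i,j)| < ε, and there exist m ≥ 1 and a probability vector r on Fin m such that (p' ⊗ e) ⊗ r ≺ (q ⊗ e₀) ⊗ r; (2) all of the following hold: (i) for every α with 0 < α < 1, A_α(p) ≥ A_α(q); (ii) ∏ i, p i ≥ ∏ i, q i; (iii) for every α > 1, A_α(p) ≤ A_α(q); (iv) H(p) ≥ H(q). -/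

import Mathlib

open Finset

/-- max over finsets of card k of the sum of entries -/
noncomputable def maxSum {ι : Type*} [Fintype ι] (p : ι → ℝ) (k : ℕ) : ℝ :=
  sSup {x : ℝ | ∃ S : Finset ι, S.card = k ∧ x = ∑ i ∈ S, p i}

/-- majorization: equal total sums, and for each k the max k-term partial sum
of `p` is at most that of `q`. -/
def Maj {ι : Type*} [Fintype ι] (p q : ι → ℝ) : Prop :=
  (∑ i, p i = ∑ i, q i) ∧ ∀ k : ℕ, maxSum p k ≤ maxSum q k

/-- a probability vector: nonnegative entries summing to one -/
def IsProbVec {ι : Type*} [Fintype ι] (p : ι → ℝ) : Prop :=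
  (∀ i, 0 ≤ p i) ∧ ∑ i, p i = 1

/-- tensor product of two vectors -/
def tensor {ι κ : Type*} (p : ι → ℝ) (r : κ → ℝ) : ι × κ → ℝ :=
  fun x => p x.1 * r x.2

/-- Shannon entropy (with `0 * log 0 = 0` automatic since `Real.log 0 = 0`) -/
noncomputable def shannon {ι : Type*} [Fintype ι] (p : ι → ℝ) : ℝ :=
  -∑ i, p i * Real.log (p i)

/-- `A_α(p) = ((1/d) ∑ i, (p i)^α)^(1/α)` -/
noncomputable def Aalpha (d : ℕ) (α : ℝ) (p : Fin d → ℝ) : ℝ :=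
  ((1 / (d : ℝ)) * ∑ i, (p i) ^ α) ^ (1 / α)

section PolyaPositivity

open Polynomial

lemma coeff_mul_nonneg {f g : ℝ[X]} (hf : ∀ k, 0 ≤ f.coeff k) (hg : ∀ k, 0 ≤ g.coeff k) (k : ℕ) :
    0 ≤ (f * g).coeff k := by
  rw [coeff_mul]
  exact Finset.sum_nonneg fun x _ => mul_nonneg (hf _) (hg _)

lemma coeff_one_add_X_pow_nonneg (n k : ℕ) : 0 ≤ (((1 + X) ^ n : ℝ[X])).coeff k := by
  rw [coeff_one_add_X_pow]; positivity

/-- A positive definite quadratic form dominates linear terms far from the origin. -/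
lemma quadratic_form_dominates_linear {a b c : ℝ} (ha : 0 < a) (hd : b ^ 2 < 4 * a * c) :
    ∃ n : ℕ, ∀ s i : ℝ, 0 ≤ s → 0 ≤ i → (n : ℝ) ≤ s + i →
      0 ≤ a * s ^ 2 - a * s + b * s * i + c * i ^ 2 - c * i := by
  have hc : 0 < c := by
    by_contra h
    nlinarith [sq_nonneg b]
  obtain ⟨δ, hδ⟩ : ∃ δ, δ = (4 * a * c - b ^ 2) / (4 * (a + c)) := ⟨_, rfl⟩
  have hδ' : δ * (4 * (a + c)) = 4 * a * c - b ^ 2 := by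
    rw [hδ]; field_simp
  have hδ0 : 0 < δ := by
    rw [hδ]; apply div_pos <;> linarith
  have hδa : δ < a := by
    by_contra h
    nlinarith [sq_nonneg b, mul_pos ha ha, mul_le_mul_of_nonneg_right (not_lt.1 h) (add_pos ha hc).le]
  obtain ⟨n, hn⟩ := exists_nat_ge (2 * (a + c) / δ)
  rw [div_le_iff₀ hδ0] at hn
  refine ⟨n, fun s i hs hi hsi => ?_⟩
  have h1 : 0 ≤ (a - δ) * s ^ 2 + b * s * i + (c - δ) * i ^ 2 := by
    have : 0 ≤ (a - δ) * ((a - δ) * s ^ 2 + b * s * i + (c - δ) * i ^ 2) := by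
      nlinarith [sq_nonneg ((a - δ) * s + b / 2 * i), sq_nonneg (δ * i), sq_nonneg i]
    exact nonneg_of_mul_nonneg_right this (by linarith)
  have h2 : (a + c) * (s + i) ≤ δ * (s ^ 2 + i ^ 2) := by
    have h3 : 2 * (a + c) ≤ (s + i) * δ := hn.trans (by gcongr)
    nlinarith [mul_le_mul_of_nonneg_right h3 (add_nonneg hs hi), sq_nonneg (s - i)]
  nlinarith

lemma exists_one_add_X_pow_mul_quadratic_coeff_nonneg {a b c : ℝ} (ha : 0 < a)
    (hd : b ^ 2 < 4 * a * c) :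
    ∃ n : ℕ, ∀ k, 0 ≤ ((1 + X) ^ n * (C a * X ^ 2 + C b * X + C c) : ℝ[X]).coeff k := by
  have hc : 0 < c := by
    by_contra h
    nlinarith [sq_nonneg b]
  obtain ⟨n, hn⟩ := quadratic_form_dominates_linear ha hd
  have expand : ((1 + X) ^ n * (C a * X ^ 2 + C b * X + C c) : ℝ[X]) =
      C a * ((1 + X) ^ n * X ^ 2) + C b * ((1 + X) ^ n * X) + C c * (1 + X) ^ n := by ring
  refine ⟨n, fun k => ?_⟩
  rw [expand]
  match k with
  | 0 => simp [coeff_one_add_X_pow, hc.le]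
  | 1 =>
    have h := hn 1 (n + 1) (by norm_num) (by positivity) (by linarith)
    have h' : 0 ≤ ((n : ℝ) + 1) * (b + c * n) := by linarith
    have := nonneg_of_mul_nonneg_right h' (by positivity)
    simpa [coeff_one_add_X_pow, coeff_mul_X_pow'] using this
  | k + 2 =>
    simp only [coeff_add, coeff_C_mul, coeff_mul_X_pow, coeff_mul_X, coeff_one_add_X_pow]
    rcases lt_or_ge n k with hk | hk
    · simp [Nat.choose_eq_zero_of_lt hk, Nat.choose_eq_zero_of_lt (show n < k + 1 by omega),
        Nat.choose_eq_zero_of_lt (show n < k + 2 by omega)]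
    · obtain ⟨i, rfl⟩ := Nat.exists_eq_add_of_le hk
      have e1 : ((k + i).choose (k + 1) : ℝ) * (k + 1) = (k + i).choose k * i := by
        have := Nat.choose_succ_right_eq (k + i) k
        rw [Nat.add_sub_cancel_left] at this
        exact_mod_cast this
      have e2 : ((k + i).choose (k + 2) : ℝ) * (k + 2) = (k + i).choose (k + 1) * (i - 1) := by
        have := Nat.choose_succ_right_eq (k + i) (k + 1)
        rcases i with _ | i
        · simp [Nat.choose_eq_zero_of_lt (show k < k + 2 by omega)]
        · rw [show k + (i + 1) - (k + 1) = i by omega] at this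
          have h := congrArg (Nat.cast : ℕ → ℝ) this
          push_cast at h ⊢
          linarith
      have h := hn (k + 2) i (by positivity) (by positivity) (by push_cast; linarith)
      have key : 0 ≤ ((k : ℝ) + 1) * (k + 2) * (a * (k + i).choose k +
          b * (k + i).choose (k + 1) + c * (k + i).choose (k + 2)) := by
        have : ((k : ℝ) + 1) * (k + 2) * (a * (k + i).choose k +
          b * (k + i).choose (k + 1) + c * (k + i).choose (k + 2)) =
          (k + i).choose k * (a * (k + 2 : ℝ) ^ 2 - a * (k + 2) + b * (k + 2) * i
            + c * i ^ 2 - c * i) := by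
          linear_combination (b * (k + 2) + c * (i - 1)) * e1 + c * (k + 1) * e2
        rw [this]
        positivity
      exact nonneg_of_mul_nonneg_right key (by positivity)

lemma exists_one_add_X_pow_mul_coeff_nonneg_or_nonpos_of_irreducible {f : ℝ[X]}
    (hf : Irreducible f) (h : ∀ u : ℝ, 0 ≤ u → f.eval u ≠ 0) :
    ∃ n : ℕ, (∀ k, 0 ≤ ((1 + X) ^ n * f).coeff k) ∨ ∀ k, 0 ≤ ((1 + X) ^ n * -f).coeff k := by
  have hdeg : f.natDegree ≤ 2 := natDegree_le_of_degree_le hf.degree_le_two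
  obtain ⟨a, b, c, hfe⟩ : ∃ a b c : ℝ, f = C a * X ^ 2 + C b * X + C c :=
    ⟨_, _, _, eq_quadratic_of_degree_le_two hf.degree_le_two⟩
  have hev : ∀ u, f.eval u = a * u ^ 2 + b * u + c := by intro u; rw [hfe]; simp
  by_cases ha : a = 0
  · subst ha
    have hbc : 0 ≤ b * c := by
      by_contra hneg
      push Not at hneg
      have hb : b ≠ 0 := by rintro rfl; simp at hneg
      have hb2 : 0 < b ^ 2 := by positivity
      refine h (-c / b) ?_ ?_
      · rw [show -c / b = -(b * c) / b ^ 2 by field_simp]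
        exact div_nonneg (by linarith) hb2.le
      · rw [hev]; field_simp; ring
    have hcoe : ∀ {b c : ℝ}, 0 ≤ b → 0 ≤ c → ∀ k, 0 ≤ (C b * X + C c : ℝ[X]).coeff k := by
      intro b c hb hc k
      match k with
      | 0 => simpa
      | 1 => simpa using hb
      | k + 2 => simp
    refine ⟨0, ?_⟩
    rw [hfe]
    rcases nonneg_and_nonneg_or_nonpos_and_nonpos_of_mul_nonneg hbc with ⟨hb, hc⟩ | ⟨hb, hc⟩
    · left; simpa using hcoe hb hc
    · right
      have := hcoe (neg_nonneg.2 hb) (neg_nonneg.2 hc)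
      convert this using 3
      simp; ring
  · have hnd : f.natDegree = 2 := by
      refine le_antisymm hdeg (le_natDegree_of_ne_zero ?_)
      rw [hfe]; simpa [coeff_X, coeff_C] using ha
    have hd : b ^ 2 < 4 * a * c := by
      by_contra hneg
      push Not at hneg
      obtain ⟨x, hx⟩ := exists_quadratic_eq_zero (a := a) (b := b) (c := c) ha
        ⟨√(discrim a b c), (Real.mul_self_sqrt (by unfold discrim; linarith)).symm⟩
      have hroot : f.IsRoot x := by rw [IsRoot, hev]; linarith
      have : f.natDegree = 1 :=
        natDegree_eq_of_degree_eq_some (degree_eq_one_of_irreducible_of_root hf hroot)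
      omega
    rcases lt_or_gt_of_ne ha with ha' | ha'
    · obtain ⟨n, hn⟩ := exists_one_add_X_pow_mul_quadratic_coeff_nonneg (a := -a) (b := -b)
        (c := -c) (by linarith) (by linarith)
      refine ⟨n, Or.inr ?_⟩
      convert hn using 4
      rw [hfe]; simp; ring
    · obtain ⟨n, hn⟩ := exists_one_add_X_pow_mul_quadratic_coeff_nonneg ha' hd
      exact ⟨n, Or.inl (hfe ▸ hn)⟩

lemma exists_one_add_X_pow_mul_coeff_nonneg_or_nonpos (f : ℝ[X])
    (h : ∀ u : ℝ, 0 ≤ u → f.eval u ≠ 0) :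
    ∃ n : ℕ, (∀ k, 0 ≤ ((1 + X) ^ n * f).coeff k) ∨ ∀ k, 0 ≤ ((1 + X) ^ n * -f).coeff k := by
  induction f using WfDvdMonoid.induction_on_irreducible with
  | zero => exact ⟨0, Or.inl (by simp)⟩
  | unit u hu =>
    obtain ⟨r, -, rfl⟩ := isUnit_iff.1 hu
    refine ⟨0, ?_⟩
    have hC : ∀ {r : ℝ}, 0 ≤ r → ∀ k, 0 ≤ (C r : ℝ[X]).coeff k := by
      intro r hr k
      rw [coeff_C]; split_ifs <;> simp [hr]
    rcases le_total 0 r with hr | hr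
    · left; simpa using hC hr
    · right; simpa only [pow_zero, one_mul, ← C_neg] using hC (neg_nonneg.2 hr)
  | mul a i _ hi ih =>
    have hu : ∀ u : ℝ, 0 ≤ u → i.eval u ≠ 0 ∧ a.eval u ≠ 0 := fun u hu => by
      have := h u hu
      rw [eval_mul] at this
      exact ⟨left_ne_zero_of_mul this, right_ne_zero_of_mul this⟩
    obtain ⟨n, hn⟩ := ih fun u h0 => (hu u h0).2
    obtain ⟨m, hm⟩ := exists_one_add_X_pow_mul_coeff_nonneg_or_nonpos_of_irreducible hi
      fun u h0 => (hu u h0).1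
    refine ⟨m + n, ?_⟩
    rcases hm with hm | hm <;> rcases hn with hn | hn
    · left; convert coeff_mul_nonneg hm hn using 3; ring
    · right; convert coeff_mul_nonneg hm hn using 3; ring
    · right; convert coeff_mul_nonneg hm hn using 3; ring
    · left; convert coeff_mul_nonneg hm hn using 3; ring

/-- **Pólya's theorem** in one variable. -/
theorem exists_one_add_X_pow_mul_coeff_nonneg {f : ℝ[X]} (h : ∀ u : ℝ, 0 ≤ u → 0 < f.eval u) :
    ∃ n : ℕ, ∀ k, 0 ≤ ((1 + X) ^ n * f).coeff k := by
  obtain ⟨n, hn | hn⟩ := exists_one_add_X_pow_mul_coeff_nonneg_or_nonpos f fun u hu => (h u hu).ne'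
  · exact ⟨n, hn⟩
  · exfalso
    have h1 : 0 ≤ ((1 + X) ^ n * -f).eval 1 := by
      rw [eval_eq_sum_range]
      exact Finset.sum_nonneg fun k _ => by simpa using hn k
    have h2 := h 1 zero_le_one
    have h3 : (0 : ℝ) < (1 + 1) ^ n := by positivity
    simp only [eval_mul, eval_pow, eval_add, eval_one, eval_X, eval_neg] at h1
    nlinarith

/-- A polynomial positive on `[1, ∞)` becomes positive on `[0, ∞)` after multiplication by a high
power of `X` and addition of `1 - X`. -/
lemma exists_X_pow_mul_add_pos {P : ℝ[X]} (hP : ∀ u : ℝ, 1 ≤ u → 0 < P.eval u) :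
    ∃ M : ℕ, ∀ u : ℝ, 0 ≤ u → 0 < (X ^ M * P + (1 - X)).eval u := by
  obtain ⟨c, hc0, hc⟩ : ∃ c > 0, ∀ u : ℝ, 1 ≤ u → c ≤ P.eval u := by
    by_cases hdeg : 0 < P.degree
    · have htop : Filter.Tendsto (fun u => P.eval u) Filter.atTop Filter.atTop := by
        refine P.tendsto_atTop_of_leadingCoeff_nonneg hdeg ?_
        by_contra hl
        have := (P.tendsto_atBot_of_leadingCoeff_nonpos hdeg (not_le.1 hl).le)
        obtain ⟨u, hu1, hu2⟩ := ((Filter.eventually_ge_atTop (1 : ℝ)).and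
          (this.eventually_lt_atBot 0)).exists
        exact absurd (hP u hu1) (not_lt.2 hu2.le)
      obtain ⟨B, hB⟩ := Filter.eventually_atTop.1 (htop.eventually_ge_atTop 1)
      have hne : (Set.Icc 1 (max 1 B)).Nonempty := ⟨1, le_rfl, le_max_left _ _⟩
      obtain ⟨z, hz, hmin⟩ := isCompact_Icc.exists_isMinOn hne P.continuous.continuousOn
      refine ⟨min 1 (P.eval z), lt_min one_pos (hP z hz.1), fun u hu => ?_⟩
      rcases le_total u (max 1 B) with h | h
      · exact (min_le_right _ _).trans (hmin ⟨hu, h⟩)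
      · exact (min_le_left _ _).trans (hB u ((le_max_right _ _).trans h))
    · rw [eq_C_of_degree_le_zero (not_lt.1 hdeg)] at hP ⊢
      exact ⟨P.coeff 0, by simpa using hP 1 le_rfl, by simp⟩
  obtain ⟨η, hη0, hη⟩ : ∃ η : ℝ, η < 1 ∧ ∀ u, η < u → u < 1 → 0 < P.eval u := by
    have : ∀ᶠ u in nhds (1 : ℝ), 0 < P.eval u :=
      P.continuous.continuousAt.eventually (lt_mem_nhds (hP 1 le_rfl))
    obtain ⟨l, r, hlr, hsub⟩ := mem_nhds_iff_exists_Ioo_subset.1 this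
    exact ⟨l, hlr.1, fun u h1 h2 => hsub ⟨h1, h2.trans hlr.2⟩⟩
  obtain ⟨B, hB⟩ := (isCompact_Icc (a := (0 : ℝ)) (b := 1)).exists_bound_of_continuousOn
    P.continuous.continuousOn
  set θ := max η 0
  have hθ0 : 0 ≤ θ := le_max_right _ _
  have hθ1 : θ < 1 := max_lt hη0 one_pos
  have hlim : Filter.Tendsto (fun M : ℕ => θ ^ M * (|B| + 1)) Filter.atTop (nhds 0) := by
    simpa using (tendsto_pow_atTop_nhds_zero_of_lt_one hθ0 hθ1).mul_const (|B| + 1)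
  obtain ⟨M, hM1, hM2⟩ := ((hlim.eventually (gt_mem_nhds (sub_pos.2 hθ1))).and
    ((tendsto_natCast_atTop_atTop (R := ℝ)).eventually_ge_atTop (1 / c))).exists
  rw [div_le_iff₀ hc0] at hM2
  refine ⟨M, fun u hu => ?_⟩
  simp only [eval_add, eval_mul, eval_pow, eval_X, eval_sub, eval_one]
  rcases le_or_gt 1 u with h1 | h1
  · have hb : 1 + (M : ℝ) * (u - 1) ≤ u ^ M := by
      simpa using one_add_mul_le_pow (a := u - 1) (by linarith) M
    have : (1 + (M : ℝ) * (u - 1)) * c ≤ u ^ M * P.eval u :=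
      mul_le_mul hb (hc u h1) hc0.le (by positivity)
    nlinarith [mul_le_mul_of_nonneg_right hM2 (sub_nonneg.2 h1)]
  · rcases lt_or_ge η u with h2 | h2
    · have := hη u h2 h1
      have : 0 ≤ u ^ M * P.eval u := by positivity
      linarith
    · have hub : u ≤ θ := h2.trans (le_max_left _ _)
      have h3 : |P.eval u| ≤ |B| + 1 :=
        ((hB u ⟨hu, h1.le⟩).trans (le_abs_self B)).trans (by linarith)
      have h4 : |u ^ M * P.eval u| ≤ θ ^ M * (|B| + 1) := by
        rw [abs_mul, abs_of_nonneg (pow_nonneg hu M)]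
        gcongr
      have := (abs_le.1 h4).1
      linarith

/-- The linear functional on polynomials sending `X ^ k` to `g k`. -/
noncomputable def monomialFunctional (g : ℕ → ℝ) : ℝ[X] →ₗ[ℝ] ℝ :=
  Polynomial.lsum fun k => LinearMap.toSpanSingleton ℝ ℝ (g k)

lemma monomialFunctional_apply (g : ℕ → ℝ) (f : ℝ[X]) :
    monomialFunctional g f = f.sum fun k a => a * g k := by
  simp [monomialFunctional, Polynomial.lsum_apply]

lemma monomialFunctional_monomial (g : ℕ → ℝ) (k : ℕ) (a : ℝ) :
    monomialFunctional g (monomial k a) = a * g k := by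
  rw [monomialFunctional_apply, sum_monomial_index (n := k) a (fun k a => a * g k) (zero_mul _)]

lemma monomialFunctional_nonneg {g : ℕ → ℝ} (hg : ∀ k, 0 ≤ g k) {f : ℝ[X]}
    (hf : ∀ k, 0 ≤ f.coeff k) : 0 ≤ monomialFunctional g f := by
  rw [monomialFunctional_apply]
  exact Finset.sum_nonneg fun k _ => mul_nonneg (hf k) (hg k)

lemma monomialFunctional_X_pow_mul (g : ℕ → ℝ) (m : ℕ) (f : ℝ[X]) :
    monomialFunctional g (X ^ m * f) = monomialFunctional (fun k => g (k + m)) f := by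
  induction f using Polynomial.induction_on' with
  | add f₁ f₂ h₁ h₂ => rw [mul_add, map_add, map_add, h₁, h₂]
  | monomial k a => rw [X_pow_mul_monomial, monomialFunctional_monomial, monomialFunctional_monomial]

lemma monomialFunctional_X_sub_C_mul (g : ℕ → ℝ) (w : ℝ) (f : ℝ[X]) :
    monomialFunctional g ((X - C w) * f) =
      monomialFunctional (fun k => g (k + 1) - w * g k) f := by
  induction f using Polynomial.induction_on' with
  | add f₁ f₂ h₁ h₂ => rw [mul_add, map_add, map_add, h₁, h₂]
  | monomial k a =>
    rw [sub_mul, map_sub, X_mul_monomial, C_mul_monomial]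
    simp only [monomialFunctional_monomial]
    ring

lemma hinge_defect_nonneg {w A t : ℝ} (hw : 1 < w) (hA : 0 < A) (ht : 0 < t) :
    0 ≤ max (w * A - t) 0 - w * max (A - t) 0 := by
  rcases le_total A t with h | h
  · simp [max_eq_right (sub_nonpos.2 h)]
  · rw [max_eq_left (sub_nonneg.2 h), max_eq_left (by nlinarith)]
    nlinarith

lemma hinge_defect_mono {w A A' t : ℝ} (hw : 1 < w) (hA : 0 < A) (hAA : A ≤ A') (ht : 0 < t) :
    max (w * A - t) 0 - w * max (A - t) 0 ≤ max (w * A' - t) 0 - w * max (A' - t) 0 := by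
  have hm : w * A ≤ w * A' := by gcongr
  rcases le_total A' t with h' | h'
  · rw [max_eq_right (sub_nonpos.2 (hAA.trans h')), max_eq_right (sub_nonpos.2 h')]
    simpa only [mul_zero, sub_zero] using max_le_max_right 0 (sub_le_sub_right hm t)
  · rw [max_eq_left (sub_nonneg.2 h'), max_eq_left (a := w * A' - t) (by nlinarith)]
    rcases le_total A t with h | h
    · rw [max_eq_right (sub_nonpos.2 h)]
      rcases le_total (w * A) t with h2 | h2
      · rw [max_eq_right (sub_nonpos.2 h2)]; nlinarith
      · rw [max_eq_left (sub_nonneg.2 h2)]; nlinarith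
    · rw [max_eq_left (sub_nonneg.2 h), max_eq_left (by nlinarith)]
      nlinarith

/-- If `P > 0` on `[1, ∞)`, then for large `n` the signed measure on the powers of `w` with
generating function `(X - w) P (1 + X) ^ n` is nonnegative against all hinge functions. -/
theorem exists_monomialFunctional_hinge_nonneg {w : ℝ} (hw : 1 < w) {P : ℝ[X]}
    (hP : ∀ u : ℝ, 1 ≤ u → 0 < P.eval u) :
    ∃ n : ℕ, ∀ t : ℝ, 0 < t →
      0 ≤ monomialFunctional (fun k => max (w ^ k - t) 0) ((X - C w) * P * (1 + X) ^ n) := by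
  obtain ⟨M, hM⟩ := exists_X_pow_mul_add_pos hP
  obtain ⟨n, hn⟩ := exists_one_add_X_pow_mul_coeff_nonneg hM
  refine ⟨n, fun t ht => ?_⟩
  have hw0 : 0 < w := by linarith
  set s := w ^ M * t with hs
  have hs0 : 0 < s := by positivity
  set F : ℝ[X] := (X - C w) * P * (1 + X) ^ n
  have hscale : w ^ M * monomialFunctional (fun k => max (w ^ k - t) 0) F =
      monomialFunctional (fun k => max (w ^ k - s) 0) (X ^ M * F) := by
    rw [monomialFunctional_X_pow_mul, monomialFunctional_apply, monomialFunctional_apply,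
      Polynomial.sum, Polynomial.sum, Finset.mul_sum]
    refine Finset.sum_congr rfl fun k _ => ?_
    rw [mul_left_comm, mul_max_of_nonneg _ _ (by positivity : 0 ≤ w ^ M), mul_zero, hs, pow_add]
    ring_nf
  have hsplit : X ^ M * F = (X - C w) * ((1 + X) ^ n * (X ^ M * P + (1 - X))) +
      (X - C w) * ((X - C 1) * (1 + X) ^ n) := by
    simp only [F, C_1]; ring
  refine nonneg_of_mul_nonneg_right (a := w ^ M) ?_ (by positivity)
  rw [hscale, hsplit, map_add, monomialFunctional_X_sub_C_mul, monomialFunctional_X_sub_C_mul,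
    monomialFunctional_X_sub_C_mul]
  refine add_nonneg (monomialFunctional_nonneg (fun k => ?_) hn)
    (monomialFunctional_nonneg (fun k => ?_) (coeff_one_add_X_pow_nonneg n))
  · have := hinge_defect_nonneg hw (pow_pos hw0 k) hs0
    rwa [← pow_succ'] at this
  · have := hinge_defect_mono hw (pow_pos hw0 k)
      (pow_le_pow_right₀ hw.le (Nat.le_succ k)) hs0
    rw [one_mul, sub_nonneg, pow_succ' w (k + 1)]
    rwa [← pow_succ'] at this

end PolyaPositivity

lemma exists_top_finset {ι : Type*} [Fintype ι] (g : ι → ℝ) {k : ℕ} (hk : k ≤ Fintype.card ι) :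
    ∃ T : Finset ι, T.card = k ∧ ∀ a ∈ T, ∀ b ∉ T, g b ≤ g a := by
  classical
  induction k with
  | zero => exact ⟨∅, by simp⟩
  | succ k ih =>
    obtain ⟨T, hT, htop⟩ := ih (by omega)
    have hne : (Tᶜ).Nonempty := by
      rw [← Finset.card_pos, Finset.card_compl]; omega
    obtain ⟨c, hc, hmax⟩ := Finset.exists_max_image Tᶜ g hne
    rw [Finset.mem_compl] at hc
    refine ⟨insert c T, by rw [Finset.card_insert_of_notMem hc, hT], fun a ha b hb => ?_⟩
    rw [Finset.mem_insert, not_or] at hb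
    rcases Finset.mem_insert.1 ha with rfl | ha
    · exact hmax b (Finset.mem_compl.2 hb.2)
    · exact htop a ha b hb.2

lemma finite_sums_of_card {ι : Type*} [Fintype ι] (f : ι → ℝ) (k : ℕ) :
    {x : ℝ | ∃ S : Finset ι, S.card = k ∧ x = ∑ i ∈ S, f i}.Finite := by
  refine (Set.finite_range fun S : Finset ι => ∑ i ∈ S, f i).subset ?_
  rintro x ⟨S, -, rfl⟩
  exact ⟨S, rfl⟩

lemma sum_le_maxSum {ι : Type*} [Fintype ι] (f : ι → ℝ) (S : Finset ι) :
    ∑ i ∈ S, f i ≤ maxSum f S.card :=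
  le_csSup (finite_sums_of_card f _).bddAbove ⟨S, rfl, rfl⟩

lemma exists_maxSum_eq {ι : Type*} [Fintype ι] (f : ι → ℝ) {k : ℕ} (hk : k ≤ Fintype.card ι) :
    ∃ S : Finset ι, S.card = k ∧ maxSum f k = ∑ i ∈ S, f i := by
  obtain ⟨S, -, hS⟩ := Finset.exists_subset_card_eq (s := (Finset.univ : Finset ι)) hk
  have hne : {x : ℝ | ∃ S : Finset ι, S.card = k ∧ x = ∑ i ∈ S, f i}.Nonempty := ⟨_, S, hS, rfl⟩
  exact hne.csSup_mem (finite_sums_of_card f k)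

theorem Maj.sum_hinge_le {ι : Type*} [Fintype ι] {f g : ι → ℝ} (h : Maj f g) (t : ℝ) :
    ∑ i, max (f i - t) 0 ≤ ∑ i, max (g i - t) 0 := by
  classical
  set S := Finset.univ.filter fun i => t < f i
  have hf : ∑ i, max (f i - t) 0 = ∑ i ∈ S, f i - S.card * t := by
    rw [← nsmul_eq_mul, ← Finset.sum_const, ← Finset.sum_sub_distrib, Finset.sum_filter]
    refine Finset.sum_congr rfl fun i _ => ?_
    split_ifs with hi
    · exact max_eq_left (sub_nonneg.2 hi.le)
    · exact max_eq_right (sub_nonpos.2 (not_lt.1 hi))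
  obtain ⟨T, hT, hmax⟩ := exists_maxSum_eq g (Finset.card_le_univ S)
  calc ∑ i, max (f i - t) 0 ≤ ∑ i ∈ T, g i - T.card * t := by
        rw [hf, hT, ← hmax]
        linarith [sum_le_maxSum f S, h.2 S.card]
    _ = ∑ i ∈ T, (g i - t) := by rw [Finset.sum_sub_distrib, Finset.sum_const, nsmul_eq_mul]
    _ ≤ ∑ i ∈ T, max (g i - t) 0 := Finset.sum_le_sum fun i _ => le_max_left _ _
    _ ≤ ∑ i, max (g i - t) 0 :=
        Finset.sum_le_sum_of_subset_of_nonneg (Finset.subset_univ T) fun i _ _ => le_max_right _ _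

theorem maj_of_sum_hinge_le {ι : Type*} [Fintype ι] {f g : ι → ℝ} (hf : ∀ i, 0 ≤ f i)
    (hg : ∀ i, 0 ≤ g i) (hsum : ∑ i, f i = ∑ i, g i)
    (h : ∀ t : ℝ, 0 < t → ∑ i, max (f i - t) 0 ≤ ∑ i, max (g i - t) 0) : Maj f g := by
  refine ⟨hsum, fun k => ?_⟩
  rcases le_or_gt k (Fintype.card ι) with hk | hk
  swap
  · have hempty : ∀ p : ι → ℝ, maxSum p k = 0 := by
      intro p
      rw [maxSum, ← Real.sSup_empty]
      congr 1
      refine Set.eq_empty_of_forall_notMem ?_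
      rintro x ⟨S, hS, -⟩
      exact absurd (Finset.card_le_univ S) (by omega)
    rw [hempty, hempty]
  rcases k.eq_zero_or_pos with rfl | hkpos
  · simp [maxSum]
  obtain ⟨S, hS, hmax⟩ := exists_maxSum_eq f hk
  obtain ⟨T, hT, htop⟩ := exists_top_finset g hk
  obtain ⟨c, hc, hmin⟩ := Finset.exists_min_image T g (Finset.card_pos.1 (hT ▸ hkpos))
  have hTle : ∑ i ∈ T, g i ≤ maxSum g k := hT ▸ sum_le_maxSum g T
  have hsupp : ∀ φ : ι → ℝ, (∀ b ∉ T, φ b = 0) → ∑ i, φ i = ∑ i ∈ T, φ i := fun φ hφ =>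
    (Finset.sum_subset (Finset.subset_univ T) fun b _ hb => hφ b hb).symm
  rw [hmax]
  refine le_trans ?_ hTle
  rcases (hg c).eq_or_lt with h0 | h0
  · rw [← hsupp g fun b hb => le_antisymm (h0 ▸ htop c hc b hb) (hg b), ← hsum]
    exact Finset.sum_le_sum_of_subset_of_nonneg (Finset.subset_univ S) fun i _ _ => hf i
  · have h1 : ∑ i, max (g i - g c) 0 = ∑ i ∈ T, g i - k * g c := by
      rw [hsupp _ fun b hb => max_eq_right (sub_nonpos.2 (htop c hc b hb)), ← hT, ← nsmul_eq_mul,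
        ← Finset.sum_const, ← Finset.sum_sub_distrib]
      exact Finset.sum_congr rfl fun i hi => max_eq_left (sub_nonneg.2 (hmin i hi))
    have h2 : ∑ i ∈ S, f i - k * g c ≤ ∑ i, max (f i - g c) 0 := by
      rw [← hS, ← nsmul_eq_mul, ← Finset.sum_const, ← Finset.sum_sub_distrib]
      exact (Finset.sum_le_sum fun i _ => le_max_left _ _).trans
        (Finset.sum_le_sum_of_subset_of_nonneg (Finset.subset_univ S) fun i _ _ => le_max_right _ _)
    linarith [h _ h0]

lemma intervalIntegrable_and_integral_min_mul_rpow {x α : ℝ} (hx0 : 0 ≤ x) (hx1 : x ≤ 1)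
    (hα : 0 < α) (hα1 : α ≠ 1) :
    IntervalIntegrable (fun t => min x t * t ^ (α - 2)) MeasureTheory.volume 0 1 ∧
      ∫ t in (0 : ℝ)..1, min x t * t ^ (α - 2) = x / (α - 1) - x ^ α / (α * (α - 1)) := by
  have hα1' : α - 1 ≠ 0 := sub_ne_zero.2 hα1
  rcases hx0.eq_or_lt with rfl | hx
  · have hz : Set.EqOn (fun _ : ℝ => (0 : ℝ)) (fun t => min 0 t * t ^ (α - 2)) (Set.uIoc 0 1) := by
      intro t ht
      rw [Set.uIoc_of_le zero_le_one] at ht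
      simp [min_eq_left ht.1.le]
    refine ⟨(intervalIntegrable_const (c := (0 : ℝ))).congr hz, ?_⟩
    rw [← intervalIntegral.integral_congr_ae (Filter.Eventually.of_forall hz)]
    simp [Real.zero_rpow hα.ne']
  · have e1 : Set.EqOn (fun t : ℝ => t ^ (α - 1)) (fun t => min x t * t ^ (α - 2))
        (Set.uIoc 0 x) := by
      intro t ht
      rw [Set.uIoc_of_le hx0] at ht
      simp only [min_eq_right ht.2]
      rw [show α - 1 = 1 + (α - 2) by ring, Real.rpow_add ht.1, Real.rpow_one]
    have e2 : Set.EqOn (fun t : ℝ => x * t ^ (α - 2)) (fun t => min x t * t ^ (α - 2))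
        (Set.uIoc x 1) := by
      intro t ht
      rw [Set.uIoc_of_le hx1] at ht
      simp only [min_eq_left ht.1.le]
    have hnot : (0 : ℝ) ∉ Set.uIcc x 1 := by
      rw [Set.uIcc_of_le hx1]; exact fun h => absurd h.1 (not_le.2 hx)
    have i1 : IntervalIntegrable (fun t => min x t * t ^ (α - 2)) MeasureTheory.volume 0 x :=
      (intervalIntegral.intervalIntegrable_rpow' (by linarith)).congr e1
    have i2 : IntervalIntegrable (fun t => min x t * t ^ (α - 2)) MeasureTheory.volume x 1 :=
      ((intervalIntegral.intervalIntegrable_rpow (Or.inr hnot)).const_mul x).congr e2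
    refine ⟨i1.trans i2, ?_⟩
    rw [← intervalIntegral.integral_add_adjacent_intervals i1 i2,
      ← intervalIntegral.integral_congr_ae (Filter.Eventually.of_forall e1), ← intervalIntegral.integral_congr_ae (Filter.Eventually.of_forall e2),
      intervalIntegral.integral_const_mul, integral_rpow (Or.inl (by linarith)),
      integral_rpow (Or.inr ⟨fun h => hα1 (by linarith), hnot⟩),
      show α - 1 + 1 = α by ring, show α - 2 + 1 = α - 1 by ring, Real.one_rpow,
      Real.zero_rpow hα.ne', show x ^ α = x * x ^ (α - 1) by
        rw [show α = 1 + (α - 1) by ring, Real.rpow_add hx, Real.rpow_one]; ring_nf]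
    field_simp
    ring

/-- Schur convexity of power sums, with the sign of `α - 1` built in. -/
theorem Maj.sum_rpow_div_le {ι : Type*} [Fintype ι] {f g : ι → ℝ} (h : Maj f g)
    (hf0 : ∀ i, 0 ≤ f i) (hf1 : ∀ i, f i ≤ 1) (hg0 : ∀ i, 0 ≤ g i) (hg1 : ∀ i, g i ≤ 1)
    {α : ℝ} (hα : 0 < α) (hα1 : α ≠ 1) :
    (∑ i, f i ^ α) / (α * (α - 1)) ≤ (∑ i, g i ^ α) / (α * (α - 1)) := by
  have hmin : ∀ t, ∑ i, min (g i) t ≤ ∑ i, min (f i) t := by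
    intro t
    have key : ∀ a : ℝ, max (a - t) 0 = a - min a t := by
      intro a
      rcases le_total a t with h | h
      · rw [min_eq_left h, max_eq_right (by linarith)]; ring
      · rw [min_eq_right h, max_eq_left (by linarith)]
    have := h.sum_hinge_le t
    simp only [key, Finset.sum_sub_distrib] at this
    linarith [h.1]
  have hF := fun i => intervalIntegrable_and_integral_min_mul_rpow (hf0 i) (hf1 i) hα hα1
  have hG := fun i => intervalIntegrable_and_integral_min_mul_rpow (hg0 i) (hg1 i) hα hα1
  have hle : ∫ t in (0 : ℝ)..1, ∑ i, min (g i) t * t ^ (α - 2) ≤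
      ∫ t in (0 : ℝ)..1, ∑ i, min (f i) t * t ^ (α - 2) := by
    refine intervalIntegral.integral_mono_on zero_le_one
      ((IntervalIntegrable.sum Finset.univ fun i _ => (hG i).1).congr
        fun t _ => Finset.sum_apply t _ _)
      ((IntervalIntegrable.sum Finset.univ fun i _ => (hF i).1).congr
        fun t _ => Finset.sum_apply t _ _) fun t ht => ?_
    simp only [← Finset.sum_mul]
    exact mul_le_mul_of_nonneg_right (hmin t) (Real.rpow_nonneg ht.1 _)
  rw [intervalIntegral.integral_finsetSum fun i _ => (hG i).1,
    intervalIntegral.integral_finsetSum fun i _ => (hF i).1] at hle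
  simp only [(hF _).2, (hG _).2, Finset.sum_sub_distrib, ← Finset.sum_div, h.1] at hle
  linarith

section Catalyst

open Polynomial

lemma one_add_X_pow_eq_sum (n : ℕ) :
    ((1 + X) ^ n : ℝ[X]) = ∑ S : Finset (Fin n), X ^ S.card := by
  have := Fintype.sum_pow_mul_eq_add_pow (Fin n) (X : ℝ[X]) 1
  simp only [one_pow, mul_one, Fintype.card_fin] at this
  rw [this, add_comm]

lemma monomialFunctional_sum_monomial_mul {ι : Type*} [Fintype ι] (g : ℕ → ℝ) (l : ι → ℕ)
    (a : ι → ℝ) (n : ℕ) :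
    monomialFunctional g ((∑ i, monomial (l i) (a i)) * (1 + X) ^ n) =
      ∑ i, ∑ S : Finset (Fin n), a i * g (l i + S.card) := by
  rw [one_add_X_pow_eq_sum, Finset.sum_mul_sum, map_sum]
  refine Finset.sum_congr rfl fun i _ => ?_
  rw [map_sum]
  refine Finset.sum_congr rfl fun S _ => ?_
  rw [X_pow_eq_monomial, monomial_mul_monomial, mul_one, monomialFunctional_monomial]

lemma mul_eval_derivative_monomial (w a : ℝ) (n : ℕ) :
    w * (derivative (monomial n a)).eval w = a * w ^ n * n := by
  rw [derivative_monomial, eval_monomial]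
  rcases n with _ | n
  · simp
  · rw [Nat.add_sub_cancel, pow_succ]; ring

lemma exists_lattice_exponents {ι : Type*} [Finite ι] (x : ι → ℝ) {w : ℝ} (hw : 1 < w) :
    ∃ K₀ : ℕ, ∀ K ≥ K₀, ∃ l : ι → ℕ, ∀ i, 0 < x i →
      w ^ l i ≤ x i * w ^ K ∧ x i * w ^ K < w ^ (l i + 1) := by
  cases nonempty_fintype ι
  have hw0 : 0 < w := by linarith
  have hlim : ∀ i, ∃ K : ℕ, 0 < x i → 1 ≤ x i * w ^ K := by
    intro i
    obtain ⟨K, hK⟩ := pow_unbounded_of_one_lt (1 / x i) hw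
    refine ⟨K, fun hi => ?_⟩
    rw [div_lt_iff₀ hi] at hK
    linarith
  choose k hk using hlim
  refine ⟨∑ i, k i, fun K hK => ?_⟩
  have : ∀ i, ∃ l : ℕ, 0 < x i → w ^ l ≤ x i * w ^ K ∧ x i * w ^ K < w ^ (l + 1) := by
    intro i
    by_cases hi : 0 < x i
    · have hle : k i ≤ K := (Finset.single_le_sum (fun j _ => Nat.zero_le (k j))
        (Finset.mem_univ i)).trans hK
      have h1 : 1 ≤ x i * w ^ K := (hk i hi).trans
        (mul_le_mul_of_nonneg_left (pow_le_pow_right₀ hw.le hle) hi.le)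
      obtain ⟨l, hl⟩ := exists_nat_pow_near h1 hw
      exact ⟨l, fun _ => hl⟩
    · exact ⟨0, fun h => absurd h hi⟩
  choose l hl using this
  exact ⟨l, hl⟩

/-- Uniformly strict power-sum inequalities yield a catalyst of the form `(1, w) ^ ⊗ n`. -/
theorem exists_forall_sum_hinge_le {ι : Type*} [Fintype ι] {x y : ι → ℝ} (hx : ∀ i, 0 ≤ x i)
    (hy : ∀ i, 0 ≤ y i) (hxy : ∑ i, x i = ∑ i, y i) {w : ℝ} (hw : 1 < w)
    (hpos : ∀ β : ℝ, 0 < β → (w ^ 2) ^ β * ∑ i, x i * x i ^ β < ∑ i, y i * y i ^ β)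
    (hneg : ∀ β : ℝ, -1 ≤ β → β < 0 → ∑ i, y i * y i ^ β < (w ^ 2) ^ β * ∑ i, x i * x i ^ β)
    (hent : 2 * Real.log w * ∑ i, x i + ∑ i, x i * Real.log (x i) < ∑ i, y i * Real.log (y i)) :
    ∃ n : ℕ, ∀ t : ℝ, 0 < t →
      ∑ i, ∑ S : Finset (Fin n), max (x i * w ^ S.card - t) 0 ≤
        ∑ i, ∑ S : Finset (Fin n), max (y i * w ^ S.card - t) 0 := by
  have hw0 : 0 < w := by linarith
  have hlogw : 0 < Real.log w := Real.log_pos hw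
  obtain ⟨K₁, hK₁⟩ := exists_lattice_exponents x hw
  obtain ⟨K₂, hK₂⟩ := exists_lattice_exponents y hw
  obtain ⟨k', hk'⟩ := hK₁ (max K₁ K₂) (le_max_left _ _)
  obtain ⟨l, hl⟩ := hK₂ (max K₁ K₂) (le_max_right _ _)
  set c := w ^ max K₁ K₂
  have hc : 0 < c := by positivity
  obtain ⟨k, hk⟩ : ∃ k : ι → ℕ, ∀ i, 0 < x i → x i * c ≤ w ^ k i ∧ w ^ k i ≤ x i * (c * w) := by
    refine ⟨fun i => k' i + 1, fun i hi => ⟨(hk' i hi).2.le, ?_⟩⟩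
    rw [pow_succ, ← mul_assoc]
    exact mul_le_mul_of_nonneg_right (hk' i hi).1 hw0.le
  have hl2 : ∀ i, 0 < y i → y i * (c / w) ≤ w ^ l i := by
    intro i hi
    rw [← mul_div_assoc, div_le_iff₀ hw0, ← pow_succ]
    exact (hl i hi).2.le
  set Dy : ℝ[X] := ∑ i, monomial (l i) (y i / w ^ l i) with hDy
  set Dx : ℝ[X] := ∑ i, monomial (k i) (x i / w ^ k i) with hDx
  have heval : ∀ (z : ι → ℝ) (e : ι → ℕ) (β : ℝ),
      (∑ i, monomial (e i) (z i / w ^ e i) : ℝ[X]).eval (w * w ^ β) =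
        ∑ i, z i * (w ^ e i) ^ β := by
    intro z e β
    rw [eval_finsetSum]
    refine Finset.sum_congr rfl fun i _ => ?_
    rw [eval_monomial, mul_pow, ← Real.rpow_natCast (w ^ β), ← Real.rpow_mul hw0.le,
      mul_comm β, Real.rpow_mul hw0.le, Real.rpow_natCast]
    field_simp
  have hroot : (Dy - Dx).IsRoot w := by
    have h1 := heval y l 0
    have h2 := heval x k 0
    simp only [Real.rpow_zero, mul_one] at h1 h2
    rw [IsRoot, eval_sub, h1, h2, hxy, sub_self]
  obtain ⟨P, hP⟩ := dvd_iff_isRoot.2 hroot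
  have hc2 : ∀ β : ℝ, (c * w) ^ β = (c / w) ^ β * (w ^ 2) ^ β := by
    intro β
    rw [← Real.mul_rpow (by positivity) (by positivity)]
    congr 1
    field_simp
  have hPpos : ∀ u : ℝ, 1 ≤ u → 0 < P.eval u := by
    intro u hu
    have hu0 : 0 < u := by linarith
    rcases eq_or_ne u w with rfl | hne
    · have hder : P.eval u = (derivative Dy).eval u - (derivative Dx).eval u := by
        have := congrArg (fun f => (derivative f).eval u) hP
        simp only [derivative_sub, derivative_mul, derivative_X, derivative_C, sub_zero, one_mul,
          eval_add, eval_mul, eval_sub, eval_X, eval_C, sub_self, zero_mul, add_zero] at this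
        exact this.symm
      have hD : ∀ (z : ι → ℝ) (e : ι → ℕ),
          u * (derivative (∑ i, monomial (e i) (z i / u ^ e i) : ℝ[X])).eval u =
            ∑ i, z i * e i := by
        intro z e
        rw [derivative_sum, eval_finsetSum, Finset.mul_sum]
        refine Finset.sum_congr rfl fun i _ => ?_
        rw [mul_eval_derivative_monomial]
        field_simp
      have hY : ∑ i, (y i * Real.log (y i) + y i * Real.log (c / u)) ≤
          (∑ i, y i * l i) * Real.log u := by
        rw [Finset.sum_mul]
        refine Finset.sum_le_sum fun i _ => ?_
        rcases (hy i).eq_or_lt with h0 | h0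
        · simp [← h0]
        · have := Real.log_le_log (by positivity) (hl2 i h0)
          rw [Real.log_mul h0.ne' (by positivity), Real.log_pow] at this
          nlinarith
      have hX : (∑ i, x i * k i) * Real.log u ≤
          ∑ i, (x i * Real.log (x i) + x i * Real.log (c * u)) := by
        rw [Finset.sum_mul]
        refine Finset.sum_le_sum fun i _ => ?_
        rcases (hx i).eq_or_lt with h0 | h0
        · simp [← h0]
        · have := Real.log_le_log (by positivity) (hk i h0).2
          rw [Real.log_mul h0.ne' (by positivity), Real.log_pow] at this
          nlinarith
      rw [Finset.sum_add_distrib, ← Finset.sum_mul] at hX hY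
      rw [Real.log_mul hc.ne' hu0.ne'] at hX
      rw [Real.log_div hc.ne' hu0.ne', ← hxy] at hY
      have hprod : 0 < u * Real.log u * P.eval u := by
        have : u * Real.log u * P.eval u =
            (∑ i, y i * l i) * Real.log u - (∑ i, x i * k i) * Real.log u := by
          rw [← hD y l, ← hD x k, hder]; ring
        rw [this]
        linarith
      exact pos_of_mul_pos_right hprod (by positivity)
    · obtain ⟨β, hβ⟩ : ∃ β : ℝ, u = w * w ^ β := by
        refine ⟨Real.log (u / w) / Real.log w, ?_⟩
        rw [Real.rpow_def_of_pos hw0, mul_div_cancel₀ _ hlogw.ne', Real.exp_log (by positivity)]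
        field_simp
      have hfac : Dy.eval u - Dx.eval u = (u - w) * P.eval u := by
        have := congrArg (fun f => f.eval u) hP
        simpa only [eval_sub, eval_mul, eval_X, eval_C] using this
      rw [hβ, hDy, hDx, heval, heval, ← hβ] at hfac
      have hcw : 0 < (c / w) ^ β := by positivity
      rcases lt_trichotomy β 0 with hβ0 | hβ0 | hβ0
      · have huw : u < w := by
          rw [hβ]
          exact mul_lt_of_lt_one_right hw0 (Real.rpow_lt_one_of_one_lt_of_neg hw hβ0)
        have hβ1 : -1 ≤ β := by
          by_contra hlt
          rw [hβ, ← Real.rpow_one_add' hw0.le (by linarith)] at hu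
          exact absurd hu (not_le.2 (Real.rpow_lt_one_of_one_lt_of_neg hw (by linarith)))
        have hY : ∑ i, y i * (w ^ l i) ^ β ≤ (c / w) ^ β * ∑ i, y i * y i ^ β := by
          rw [Finset.mul_sum]
          refine Finset.sum_le_sum fun i _ => ?_
          rcases (hy i).eq_or_lt with h0 | h0
          · simp [← h0]
          · rw [mul_left_comm, mul_comm (_ ^ β), ← Real.mul_rpow h0.le (by positivity)]
            exact mul_le_mul_of_nonneg_left
              (Real.rpow_le_rpow_of_nonpos (by positivity) (hl2 i h0) hβ0.le) h0.le
        have hX : (c * w) ^ β * ∑ i, x i * x i ^ β ≤ ∑ i, x i * (w ^ k i) ^ β := by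
          rw [Finset.mul_sum]
          refine Finset.sum_le_sum fun i _ => ?_
          rcases (hx i).eq_or_lt with h0 | h0
          · simp [← h0]
          · rw [mul_left_comm, mul_comm (_ ^ β), ← Real.mul_rpow h0.le (by positivity)]
            exact mul_le_mul_of_nonneg_left
              (Real.rpow_le_rpow_of_nonpos (by positivity) (hk i h0).2 hβ0.le) h0.le
        have := mul_lt_mul_of_pos_left (hneg β hβ1 hβ0) hcw
        rw [← mul_assoc, ← hc2] at this
        nlinarith
      · exact absurd hβ (by simpa [hβ0] using hne)
      · have huw : w < u := by
          rw [hβ]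
          exact lt_mul_of_one_lt_right hw0 (Real.one_lt_rpow hw hβ0)
        have hY : (c / w) ^ β * ∑ i, y i * y i ^ β ≤ ∑ i, y i * (w ^ l i) ^ β := by
          rw [Finset.mul_sum]
          refine Finset.sum_le_sum fun i _ => ?_
          rcases (hy i).eq_or_lt with h0 | h0
          · simp [← h0]
          · rw [mul_left_comm, mul_comm (_ ^ β), ← Real.mul_rpow h0.le (by positivity)]
            exact mul_le_mul_of_nonneg_left
              (Real.rpow_le_rpow (by positivity) (hl2 i h0) hβ0.le) h0.le
        have hX : ∑ i, x i * (w ^ k i) ^ β ≤ (c * w) ^ β * ∑ i, x i * x i ^ β := by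
          rw [Finset.mul_sum]
          refine Finset.sum_le_sum fun i _ => ?_
          rcases (hx i).eq_or_lt with h0 | h0
          · simp [← h0]
          · rw [mul_left_comm, mul_comm (_ ^ β), ← Real.mul_rpow h0.le (by positivity)]
            exact mul_le_mul_of_nonneg_left
              (Real.rpow_le_rpow (by positivity) (hk i h0).2 hβ0.le) h0.le
        have := mul_lt_mul_of_pos_left (hpos β hβ0) hcw
        rw [← mul_assoc, ← hc2] at this
        nlinarith
  obtain ⟨n, hn⟩ := exists_monomialFunctional_hinge_nonneg hw hPpos
  refine ⟨n, fun t ht => ?_⟩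
  have hmain := hn (c * t) (by positivity)
  rw [← hP, sub_mul, map_sub, hDx, hDy, monomialFunctional_sum_monomial_mul,
    monomialFunctional_sum_monomial_mul, sub_nonneg] at hmain
  refine le_trans ?_ (hmain.trans ?_)
  · refine Finset.sum_le_sum fun i _ => Finset.sum_le_sum fun S _ => ?_
    rcases (hx i).eq_or_lt with h0 | h0
    · simp [← h0, ht.le]
    · have hwk : 0 < w ^ k i := by positivity
      rw [mul_max_of_nonneg _ _ (by positivity), mul_zero, pow_add]
      refine max_le_max_right _ ?_
      have : x i * c / w ^ k i ≤ 1 := (div_le_one hwk).2 (hk i h0).1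
      have e : x i / w ^ k i * (w ^ k i * w ^ S.card - c * t) =
        x i * w ^ S.card - x i * c / w ^ k i * t := by field_simp
      rw [e]
      nlinarith
  · refine Finset.sum_le_sum fun i _ => Finset.sum_le_sum fun S _ => ?_
    rcases (hy i).eq_or_lt with h0 | h0
    · simp [← h0]
    · have hwk : 0 < w ^ l i := by positivity
      rw [mul_max_of_nonneg _ _ (by positivity), mul_zero, pow_add]
      refine max_le_max_right _ ?_
      have : 1 ≤ y i * c / w ^ l i := (one_le_div hwk).2 (hl i h0).1
      have e : y i / w ^ l i * (w ^ l i * w ^ S.card - c * t) =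
        y i * w ^ S.card - y i * c / w ^ l i * t := by field_simp
      rw [e]
      nlinarith

end Catalyst

lemma IsProbVec.le_one {ι : Type*} [Fintype ι] {p : ι → ℝ} (hp : IsProbVec p) (i : ι) :
    p i ≤ 1 :=
  hp.2 ▸ Finset.single_le_sum (fun j _ => hp.1 j) (Finset.mem_univ i)

lemma sum_tensor {ι κ : Type*} [Fintype ι] [Fintype κ] (p : ι → ℝ) (r : κ → ℝ) :
    ∑ x, tensor p r x = (∑ i, p i) * ∑ j, r j := by
  rw [Fintype.sum_prod_type, Finset.sum_mul_sum]
  rfl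

lemma IsProbVec.tensor {ι κ : Type*} [Fintype ι] [Fintype κ] {p : ι → ℝ} {r : κ → ℝ}
    (hp : IsProbVec p) (hr : IsProbVec r) : IsProbVec (tensor p r) :=
  ⟨fun x => mul_nonneg (hp.1 _) (hr.1 _), by rw [sum_tensor, hp.2, hr.2, one_mul]⟩

lemma isProbVec_pure : IsProbVec (![1, 0] : Fin 2 → ℝ) :=
  ⟨fun i => by fin_cases i <;> simp, by simp⟩

/-- The power sum of exponent `1 + β` over the support of `p`. -/
noncomputable def biasedPowerSum {ι : Type*} [Fintype ι] (p : ι → ℝ) (β : ℝ) : ℝ :=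
  ∑ i, p i * p i ^ β

lemma biasedPowerSum_eq_sum_rpow {ι : Type*} [Fintype ι] {p : ι → ℝ} (hp : ∀ i, 0 ≤ p i) {β : ℝ}
    (hβ : 1 + β ≠ 0) : biasedPowerSum p β = ∑ i, p i ^ (1 + β) :=
  Finset.sum_congr rfl fun i _ => (Real.rpow_one_add' (hp i) hβ).symm

lemma biasedPowerSum_tensor {ι κ : Type*} [Fintype ι] [Fintype κ] {p : ι → ℝ} {r : κ → ℝ}
    (hp : ∀ i, 0 ≤ p i) (hr : ∀ j, 0 ≤ r j) (β : ℝ) :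
    biasedPowerSum (tensor p r) β = biasedPowerSum p β * biasedPowerSum r β := by
  rw [biasedPowerSum, Fintype.sum_prod_type, biasedPowerSum, biasedPowerSum, Finset.sum_mul_sum]
  refine Finset.sum_congr rfl fun i _ => Finset.sum_congr rfl fun j _ => ?_
  simp only [tensor]
  rw [Real.mul_rpow (hp i) (hr j)]
  ring

lemma IsProbVec.biasedPowerSum_pos {ι : Type*} [Fintype ι] {p : ι → ℝ} (hp : IsProbVec p)
    (β : ℝ) : 0 < biasedPowerSum p β := by
  obtain ⟨i, hi⟩ : ∃ i, 0 < p i := by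
    by_contra! h
    linarith [hp.2, Finset.sum_nonpos fun i (_ : i ∈ Finset.univ) => h i]
  refine Finset.sum_pos' (fun j _ => mul_nonneg (hp.1 j) (Real.rpow_nonneg (hp.1 j) _))
    ⟨i, Finset.mem_univ i, by positivity⟩

lemma hasDerivAt_biasedPowerSum {ι : Type*} [Fintype ι] {p : ι → ℝ} (hp : ∀ i, 0 ≤ p i) (β : ℝ) :
    HasDerivAt (biasedPowerSum p) (∑ i, p i * (p i ^ β * Real.log (p i))) β := by
  refine HasDerivAt.fun_sum fun i _ => ?_
  rcases (hp i).eq_or_lt with h | h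
  · simpa [← h] using hasDerivAt_const β (0 : ℝ)
  · exact (Real.hasStrictDerivAt_const_rpow h β).hasDerivAt.const_mul (p i)

lemma IsProbVec.biasedPowerSum_zero {ι : Type*} [Fintype ι] {p : ι → ℝ} (hp : IsProbVec p) :
    biasedPowerSum p 0 = 1 := by
  simp [biasedPowerSum, hp.2]

lemma HasDerivAt.le_of_eq_of_forall_gt_le {f g : ℝ → ℝ} {f' g' a b : ℝ} (hf : HasDerivAt f f' a)
    (hg : HasDerivAt g g' a) (hab : a < b) (ha : f a = g a)
    (h : ∀ x, a < x → x < b → f x ≤ g x) : f' ≤ g' := by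
  have hd := (hg.sub hf).tendsto_slope.mono_left
    (nhdsWithin_mono a (fun x (hx : a < x) => hx.ne') : nhdsWithin a (Set.Ioi a) ≤ _)
  refine sub_nonneg.1 (ge_of_tendsto hd ?_)
  filter_upwards [Ioo_mem_nhdsGT hab] with x hx
  rw [slope_def_field]
  refine div_nonneg ?_ (sub_nonneg.2 hx.1.le)
  simp only [Pi.sub_apply]
  linarith [h x hx.1 hx.2]

lemma biasedPowerSum_neg_one_le {ι : Type*} [Fintype ι] {p q : ι → ℝ} (hp : ∀ i, 0 ≤ p i)
    (hq : ∀ i, 0 ≤ q i)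
    (h : ∀ β : ℝ, -1 < β → β < 0 → biasedPowerSum q β ≤ biasedPowerSum p β) :
    biasedPowerSum q (-1) ≤ biasedPowerSum p (-1) := by
  have hcont : ∀ {z : ι → ℝ}, (∀ i, 0 ≤ z i) → Filter.Tendsto (biasedPowerSum z)
      (nhdsWithin (-1) (Set.Ioi (-1))) (nhds (biasedPowerSum z (-1))) := fun hz =>
    (hasDerivAt_biasedPowerSum hz (-1)).continuousAt.tendsto.mono_left nhdsWithin_le_nhds
  refine le_of_tendsto_of_tendsto (hcont hq) (hcont hp) ?_
  filter_upwards [Ioo_mem_nhdsGT (show (-1 : ℝ) < 0 by norm_num)] with β hβ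
  exact h β hβ.1 hβ.2

lemma shannon_eq_neg_deriv {ι : Type*} [Fintype ι] (p : ι → ℝ) :
    shannon p = -∑ i, p i * (p i ^ (0 : ℝ) * Real.log (p i)) := by
  simp [shannon]

theorem shannon_le_of_biasedPowerSum_le {ι : Type*} [Fintype ι] {p q : ι → ℝ} (hp : IsProbVec p)
    (hq : IsProbVec q) (h : ∀ β : ℝ, 0 < β → biasedPowerSum p β ≤ biasedPowerSum q β) :
    shannon q ≤ shannon p := by
  rw [shannon_eq_neg_deriv, shannon_eq_neg_deriv]
  exact neg_le_neg ((hasDerivAt_biasedPowerSum hp.1 0).le_of_eq_of_forall_gt_le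
    (hasDerivAt_biasedPowerSum hq.1 0) one_pos
    (by rw [hp.biasedPowerSum_zero, hq.biasedPowerSum_zero]) fun β hβ _ => h β hβ)

theorem prod_le_prod_of_biasedPowerSum_le {ι : Type*} [Fintype ι] {p q : ι → ℝ}
    (hp : ∀ i, 0 ≤ p i) (hq : ∀ i, 0 ≤ q i)
    (h : ∀ β : ℝ, -1 < β → β < 0 → biasedPowerSum q β ≤ biasedPowerSum p β) :
    ∏ i, q i ≤ ∏ i, p i := by
  by_cases hq0 : ∃ i, q i = 0
  · obtain ⟨i, hi⟩ := hq0
    rw [Finset.prod_eq_zero (Finset.mem_univ i) hi]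
    exact Finset.prod_nonneg fun i _ => hp i
  push Not at hq0
  have hcard : ∀ {z : ι → ℝ}, (∀ i, z i ≠ 0) → biasedPowerSum z (-1) = Fintype.card ι := by
    intro z hz
    simp [biasedPowerSum, Real.rpow_neg_one, hz]
  have hlim := biasedPowerSum_neg_one_le hp hq h
  have hp0 : ∀ i, p i ≠ 0 := by
    intro i hi
    rw [hcard hq0] at hlim
    have hlt : biasedPowerSum p (-1) < ∑ _i : ι, (1 : ℝ) := by
      refine Finset.sum_lt_sum (fun j _ => ?_) ⟨i, Finset.mem_univ i, by simp [hi]⟩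
      rw [Real.rpow_neg_one]
      exact mul_inv_le_one
    simp at hlt
    linarith
  have hder : ∀ {z : ι → ℝ}, (∀ i, z i ≠ 0) →
      ∑ i, z i * (z i ^ (-1 : ℝ) * Real.log (z i)) = Real.log (∏ i, z i) := by
    intro z hz
    rw [Real.log_prod fun i _ => hz i]
    refine Finset.sum_congr rfl fun i _ => ?_
    rw [Real.rpow_neg_one, mul_inv_cancel_left₀ (hz i)]
  have := (hasDerivAt_biasedPowerSum hq (-1)).le_of_eq_of_forall_gt_le
    (hasDerivAt_biasedPowerSum hp (-1)) (show (-1 : ℝ) < 0 by norm_num)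
    (by rw [hcard hq0, hcard hp0]) h
  rw [hder hq0, hder hp0] at this
  exact (Real.log_le_log_iff (Finset.prod_pos fun i _ => (hq i).lt_of_ne' (hq0 i))
    (Finset.prod_pos fun i _ => (hp i).lt_of_ne' (hp0 i))).1 this

lemma Aalpha_le_iff {d : ℕ} {p q : Fin d → ℝ} (hp : IsProbVec p) (hq : IsProbVec q) {β : ℝ}
    (hβ : 0 < 1 + β) :
    Aalpha d (1 + β) p ≤ Aalpha d (1 + β) q ↔ biasedPowerSum p β ≤ biasedPowerSum q β := by
  have hd : 0 < d := by
    rcases Nat.eq_zero_or_pos d with rfl | h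
    · simpa using hp.2
    · exact h
  rw [biasedPowerSum_eq_sum_rpow hp.1 hβ.ne', biasedPowerSum_eq_sum_rpow hq.1 hβ.ne', Aalpha, Aalpha,
    Real.rpow_le_rpow_iff _ _ (by positivity), mul_le_mul_iff_right₀ (by positivity)]
  · exact mul_nonneg (by positivity) (Finset.sum_nonneg fun i _ => Real.rpow_nonneg (hp.1 i) _)
  · exact mul_nonneg (by positivity) (Finset.sum_nonneg fun i _ => Real.rpow_nonneg (hq.1 i) _)

/-- The conditions on `A_α` for `α > 0`, expressed through power sums. -/
lemma forall_Aalpha_le_iff {d : ℕ} {p q : Fin d → ℝ} (hp : IsProbVec p) (hq : IsProbVec q) :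
    ((∀ α : ℝ, 0 < α → α < 1 → Aalpha d α q ≤ Aalpha d α p) ∧
        ∀ α : ℝ, 1 < α → Aalpha d α p ≤ Aalpha d α q) ↔
      (∀ β : ℝ, -1 < β → β < 0 → biasedPowerSum q β ≤ biasedPowerSum p β) ∧
        ∀ β : ℝ, 0 < β → biasedPowerSum p β ≤ biasedPowerSum q β := by
  constructor
  · rintro ⟨h1, h2⟩
    exact ⟨fun β hβ hβ' => (Aalpha_le_iff hq hp (by linarith)).1
      (h1 _ (by linarith) (by linarith)), fun β hβ => (Aalpha_le_iff hp hq (by linarith)).1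
      (h2 _ (by linarith))⟩
  · rintro ⟨h1, h2⟩
    refine ⟨fun α hα hα' => ?_, fun α hα => ?_⟩
    · obtain ⟨β, rfl⟩ : ∃ β, α = 1 + β := ⟨α - 1, by ring⟩
      exact (Aalpha_le_iff hq hp hα).2 (h1 β (by linarith) (by linarith))
    · obtain ⟨β, rfl⟩ : ∃ β, α = 1 + β := ⟨α - 1, by ring⟩
      exact (Aalpha_le_iff hp hq (by linarith)).2 (h2 β (by linarith))

lemma biasedPowerSum_pure {β : ℝ} : biasedPowerSum (![1, 0] : Fin 2 → ℝ) β = 1 := by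
  simp [biasedPowerSum]

lemma Maj.biasedPowerSum_div_le {ι κ : Type*} [Fintype ι] [Fintype κ] {f g : ι → ℝ} {r : κ → ℝ}
    (hf : IsProbVec f) (hg : IsProbVec g) (hr : IsProbVec r)
    (h : Maj (tensor f r) (tensor g r)) {β : ℝ} (hβ : -1 < β) (hβ0 : β ≠ 0) :
    biasedPowerSum f β / β ≤ biasedPowerSum g β / β := by
  have hβ1 : 0 < 1 + β := by linarith
  have hfr := hf.tensor hr
  have hgr := hg.tensor hr
  have := h.sum_rpow_div_le hfr.1 hfr.le_one hgr.1 hgr.le_one hβ1 (by simpa using hβ0)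
  rw [← biasedPowerSum_eq_sum_rpow hfr.1 hβ1.ne', ← biasedPowerSum_eq_sum_rpow hgr.1 hβ1.ne',
    biasedPowerSum_tensor hf.1 hr.1, biasedPowerSum_tensor hg.1 hr.1] at this
  have hc : 0 < biasedPowerSum r β / (1 + β) := div_pos (hr.biasedPowerSum_pos β) hβ1
  refine le_of_mul_le_mul_right ?_ hc
  rw [add_sub_cancel_left] at this
  rwa [div_mul_div_comm, div_mul_div_comm, mul_comm β]

/-- The power-sum inequality passes to vectors approximable by catalytically convertible ones. -/
lemma biasedPowerSum_div_le_of_forall_approx {ι : Type*} [Fintype ι] {f g : ι → ℝ}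
    (hf : IsProbVec f) (hg : IsProbVec g)
    (h : ∀ ε : ℝ, 0 < ε → ∃ f' : ι → ℝ, IsProbVec f' ∧ ∑ i, |f' i - f i| < ε ∧
      ∃ m : ℕ, ∃ r : Fin m → ℝ, IsProbVec r ∧ Maj (tensor f' r) (tensor g r))
    {β : ℝ} (hβ : -1 < β) (hβ0 : β ≠ 0) :
    biasedPowerSum f β / β ≤ biasedPowerSum g β / β := by
  have hβ1 : 0 < 1 + β := by linarith
  have hcont : Continuous fun z : ι → ℝ => (∑ i, z i ^ (1 + β)) / β :=
    (continuous_finsetSum _ fun i _ =>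
      (Real.continuous_rpow_const hβ1.le).comp (continuous_apply i)).div_const β
  have hclosed := isClosed_le hcont (continuous_const (y := biasedPowerSum g β / β))
  rw [biasedPowerSum_eq_sum_rpow hf.1 hβ1.ne']
  refine hclosed.closure_subset (Metric.mem_closure_iff.2 fun ε hε => ?_)
  obtain ⟨f', hf', hlt, m, r, hr, hmaj⟩ := h ε hε
  refine ⟨f', ?_, ?_⟩
  · have := hmaj.biasedPowerSum_div_le hf' hg hr hβ hβ0
    rwa [biasedPowerSum_eq_sum_rpow hf'.1 hβ1.ne'] at this
  · rw [dist_comm, dist_pi_lt_iff hε]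
    exact fun i => (Finset.single_le_sum (f := fun i => |f' i - f i|)
      (fun j _ => abs_nonneg _) (Finset.mem_univ i)).trans_lt hlt

/-- Normalized `n`-fold tensor power of `(1, w)`, turned into a catalyst on some `Fin m`. -/
lemma exists_catalyst_of_sum_hinge_le {ι : Type*} [Fintype ι] {x y : ι → ℝ} (hx : IsProbVec x)
    (hy : IsProbVec y) {w : ℝ} (hw : 0 < w) {n : ℕ}
    (h : ∀ t : ℝ, 0 < t → ∑ i, ∑ S : Finset (Fin n), max (x i * w ^ S.card - t) 0 ≤
        ∑ i, ∑ S : Finset (Fin n), max (y i * w ^ S.card - t) 0) :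
    ∃ m : ℕ, 1 ≤ m ∧ ∃ r : Fin m → ℝ, IsProbVec r ∧ Maj (tensor x r) (tensor y r) := by
  set e := Fintype.equivFin (Finset (Fin n))
  set Z := ∑ S : Finset (Fin n), w ^ S.card with hZ
  have hZ0 : 0 < Z := Finset.sum_pos (fun S _ => by positivity) Finset.univ_nonempty
  set r : Fin (Fintype.card (Finset (Fin n))) → ℝ := fun j => w ^ (e.symm j).card / Z with hr
  have hrp : IsProbVec r := by
    refine ⟨fun j => by simp only [hr]; positivity, ?_⟩
    rw [← Finset.sum_div, Equiv.sum_comp e.symm fun S => w ^ S.card, ← hZ, div_self hZ0.ne']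
  refine ⟨_, Fintype.card_pos, r, hrp, ?_⟩
  have hxr := hx.tensor hrp
  have hyr := hy.tensor hrp
  refine maj_of_sum_hinge_le hxr.1 hyr.1 (hxr.2.trans hyr.2.symm) fun t ht => ?_
  have key : ∀ z : ι → ℝ, Z * ∑ a, max (tensor z r a - t) 0 =
      ∑ i, ∑ S : Finset (Fin n), max (z i * w ^ S.card - Z * t) 0 := by
    intro z
    rw [Fintype.sum_prod_type, Finset.mul_sum]
    refine Finset.sum_congr rfl fun i _ => ?_
    rw [← Equiv.sum_comp e.symm, Finset.mul_sum]
    refine Finset.sum_congr rfl fun j _ => ?_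
    rw [mul_max_of_nonneg _ _ hZ0.le, mul_zero]
    congr 1
    simp only [tensor, hr]
    field_simp
  refine le_of_mul_le_mul_left ?_ hZ0
  rw [key, key]
  exact h _ (by positivity)

/-- A noisy ancilla turns the weak power-sum inequalities into catalytic convertibility. -/
theorem exists_catalyst_tensor_noisy {ι : Type*} [Fintype ι] {p q : ι → ℝ} (hp : IsProbVec p)
    (hq : IsProbVec q)
    (hlow : ∀ β : ℝ, -1 < β → β < 0 → biasedPowerSum q β ≤ biasedPowerSum p β)
    (hhigh : ∀ β : ℝ, 0 < β → biasedPowerSum p β ≤ biasedPowerSum q β)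
    (hent : shannon q ≤ shannon p) {δ : ℝ} (hδ0 : 0 < δ) (hδ1 : δ ≤ 1 / 2) :
    ∃ m : ℕ, 1 ≤ m ∧ ∃ r : Fin m → ℝ, IsProbVec r ∧
      Maj (tensor (tensor p ![1 - δ, δ]) r) (tensor (tensor q ![1, 0]) r) := by
  have he : IsProbVec (![1 - δ, δ] : Fin 2 → ℝ) :=
    ⟨fun i => by fin_cases i <;> simp <;> linarith, by simp⟩
  have hx := hp.tensor he
  have hy := hq.tensor isProbVec_pure
  have h1δ : 0 < 1 - δ := by linarith
  set w := 1 + δ / 4 with hw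
  have hw1 : 1 < w := by linarith
  have hw0 : 0 < w := by linarith
  have hwδ : w ^ 2 * (1 - δ) < 1 := by rw [hw]; nlinarith [mul_pos hδ0 hδ0, pow_pos hδ0 3]
  have hwδ0 : 0 < w ^ 2 * (1 - δ) := by positivity
  have hE : ∀ β, biasedPowerSum (![1 - δ, δ] : Fin 2 → ℝ) β =
      (1 - δ) * (1 - δ) ^ β + δ * δ ^ β := by
    intro β; simp [biasedPowerSum]
  have hX : ∀ β, biasedPowerSum (tensor p ![1 - δ, δ]) β =
      biasedPowerSum p β * ((1 - δ) * (1 - δ) ^ β + δ * δ ^ β) := by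
    intro β; rw [biasedPowerSum_tensor hp.1 he.1, hE]
  have hY : ∀ β, biasedPowerSum (tensor q ![1, 0]) β = biasedPowerSum q β := by
    intro β; rw [biasedPowerSum_tensor hq.1 isProbVec_pure.1, biasedPowerSum_pure, mul_one]
  obtain ⟨n, hn⟩ := exists_forall_sum_hinge_le hx.1 hy.1 (hx.2.trans hy.2.symm) hw1
    (fun β hβ => by
      change _ * biasedPowerSum _ β < biasedPowerSum _ β
      rw [hX, hY]
      have h1 : (w ^ 2) ^ β * (1 - δ) ^ β < 1 := by
        rw [← Real.mul_rpow (by positivity) h1δ.le]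
        exact Real.rpow_lt_one hwδ0.le hwδ hβ
      have h2 : δ ^ β ≤ (1 - δ) ^ β := Real.rpow_le_rpow hδ0.le (by linarith) hβ.le
      have h3 : (1 - δ) * (1 - δ) ^ β + δ * δ ^ β ≤ (1 - δ) ^ β := by nlinarith
      have hp0 := hp.biasedPowerSum_pos β
      have hw2 : 0 < (w ^ 2) ^ β := by positivity
      calc (w ^ 2) ^ β * (biasedPowerSum p β * ((1 - δ) * (1 - δ) ^ β + δ * δ ^ β))
          ≤ (w ^ 2) ^ β * (biasedPowerSum p β * (1 - δ) ^ β) := by gcongr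
        _ = biasedPowerSum p β * ((w ^ 2) ^ β * (1 - δ) ^ β) := by ring
        _ < biasedPowerSum p β := mul_lt_of_lt_one_right hp0 h1
        _ ≤ biasedPowerSum q β := hhigh β hβ)
    (fun β hβ1 hβ => by
      change biasedPowerSum _ β < _ * biasedPowerSum _ β
      rw [hX, hY]
      have h0 : biasedPowerSum q β ≤ biasedPowerSum p β := by
        rcases hβ1.eq_or_lt with rfl | h
        · exact biasedPowerSum_neg_one_le hp.1 hq.1 hlow
        · exact hlow β h hβ
      have h1 : 1 < (w ^ 2) ^ β * (1 - δ) ^ β := by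
        rw [← Real.mul_rpow (by positivity) h1δ.le]
        exact Real.one_lt_rpow_of_pos_of_lt_one_of_neg hwδ0 hwδ hβ
      have h2 : (1 - δ) ^ β ≤ δ ^ β := Real.rpow_le_rpow_of_nonpos hδ0 (by linarith) hβ.le
      have h3 : (1 - δ) ^ β ≤ (1 - δ) * (1 - δ) ^ β + δ * δ ^ β := by nlinarith
      have hp0 := hp.biasedPowerSum_pos β
      have hw2 : 0 < (w ^ 2) ^ β := by positivity
      calc biasedPowerSum q β ≤ biasedPowerSum p β := h0
        _ < biasedPowerSum p β * ((w ^ 2) ^ β * (1 - δ) ^ β) := lt_mul_of_one_lt_right hp0 h1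
        _ = (w ^ 2) ^ β * (biasedPowerSum p β * (1 - δ) ^ β) := by ring
        _ ≤ _ := by gcongr)
    (by
      have hlog : 2 * Real.log w + Real.log (1 - δ) < 0 := by
        have := Real.log_neg hwδ0 hwδ
        rw [Real.log_mul (by positivity) h1δ.ne', Real.log_pow] at this
        exact_mod_cast this
      have hlogδ : Real.log δ ≤ Real.log (1 - δ) := Real.log_le_log hδ0 (by linarith)
      have hxlog : ∑ i, tensor p ![1 - δ, δ] i * Real.log (tensor p ![1 - δ, δ] i) =
          ∑ i, (p i * Real.log (p i) + p i * ((1 - δ) * Real.log (1 - δ) + δ * Real.log δ)) := by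
        rw [Fintype.sum_prod_type]
        refine Finset.sum_congr rfl fun i _ => ?_
        rcases (hp.1 i).eq_or_lt with h | h
        · simp [tensor, ← h]
        · simp only [tensor, Fin.sum_univ_two, Matrix.cons_val_zero, Matrix.cons_val_one]
          rw [Real.log_mul h.ne' h1δ.ne', Real.log_mul h.ne' hδ0.ne']
          ring
      have hylog : ∑ i, tensor q ![1, 0] i * Real.log (tensor q ![1, 0] i) =
          ∑ i, q i * Real.log (q i) := by
        rw [Fintype.sum_prod_type]
        simp [tensor]
      rw [hxlog, hylog, hx.2, Finset.sum_add_distrib, ← Finset.sum_mul, hp.2]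
      simp only [shannon] at hent
      nlinarith)
  exact exists_catalyst_of_sum_hinge_le hx hy hw0 hn


/-- After appending an ancillary qubit in the state `|0⟩` and allowing
ε-perturbations, only the Rényi-entropy conditions for `α ∈ [0,∞)` remain. -/
theorem approx_catalytic_majorization_with_ancilla_iff
    (d : ℕ) (p q : Fin d → ℝ) (hp : IsProbVec p) (hq : IsProbVec q) :
    (∀ ε : ℝ, 0 < ε →
      ∃ p' : Fin d → ℝ, ∃ e : Fin 2 → ℝ, IsProbVec p' ∧ IsProbVec e ∧
        (∑ x : Fin d × Fin 2, |tensor p' e x - tensor p ![1, 0] x| < ε) ∧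
        ∃ m : ℕ, 1 ≤ m ∧ ∃ r : Fin m → ℝ, IsProbVec r ∧
          Maj (tensor (tensor p' e) r) (tensor (tensor q ![1, 0]) r))
    ↔ ((∀ α : ℝ, 0 < α → α < 1 → Aalpha d α q ≤ Aalpha d α p) ∧
       (∏ i, q i ≤ ∏ i, p i) ∧
       (∀ α : ℝ, 1 < α → Aalpha d α p ≤ Aalpha d α q) ∧
       shannon q ≤ shannon p) := by
  have hq' := hq.tensor isProbVec_pure
  have hp' := hp.tensor isProbVec_pure
  have hpure : ∀ {z : Fin d → ℝ}, IsProbVec z → ∀ β,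
      biasedPowerSum (tensor z ![1, 0]) β = biasedPowerSum z β := fun hz β => by
    rw [biasedPowerSum_tensor hz.1 isProbVec_pure.1, biasedPowerSum_pure, mul_one]
  constructor
  · intro h
    have hdiv : ∀ β : ℝ, -1 < β → β ≠ 0 → biasedPowerSum p β / β ≤ biasedPowerSum q β / β := by
      intro β hβ hβ0
      rw [← hpure hp, ← hpure hq]
      refine biasedPowerSum_div_le_of_forall_approx hp' hq' (fun ε hε => ?_) hβ hβ0
      obtain ⟨p', e, hp1, he, hlt, m, -, r, hr, hmaj⟩ := h ε hε
      exact ⟨tensor p' e, hp1.tensor he, hlt, m, r, hr, hmaj⟩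
    have hlow : ∀ β : ℝ, -1 < β → β < 0 → biasedPowerSum q β ≤ biasedPowerSum p β :=
      fun β hβ hβ0 => (div_le_div_right_of_neg hβ0).1 (hdiv β hβ hβ0.ne)
    have hhigh : ∀ β : ℝ, 0 < β → biasedPowerSum p β ≤ biasedPowerSum q β :=
      fun β hβ => (div_le_div_iff_of_pos_right hβ).1 (hdiv β (by linarith) hβ.ne')
    obtain ⟨h1, h2⟩ := (forall_Aalpha_le_iff hp hq).2 ⟨hlow, hhigh⟩
    exact ⟨h1, prod_le_prod_of_biasedPowerSum_le hp.1 hq.1 hlow, h2,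
      shannon_le_of_biasedPowerSum_le hp hq hhigh⟩
  · rintro ⟨h1, -, h2, hent⟩ ε hε
    obtain ⟨hlow, hhigh⟩ := (forall_Aalpha_le_iff hp hq).1 ⟨h1, h2⟩
    set δ := min (ε / 4) (1 / 2)
    have hδ0 : 0 < δ := lt_min (by linarith) (by norm_num)
    have hδ1 : δ ≤ 1 / 2 := min_le_right _ _
    have hδε : δ ≤ ε / 4 := min_le_left _ _
    refine ⟨p, ![1 - δ, δ], hp, ⟨fun i => by fin_cases i <;> simp <;> linarith, by simp⟩, ?_,
      exists_catalyst_tensor_noisy hp hq hlow hhigh hent hδ0 hδ1⟩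
    have hsum : ∑ x : Fin d × Fin 2, |tensor p ![1 - δ, δ] x - tensor p ![1, 0] x| =
        ∑ i, p i * (2 * δ) := by
      rw [Fintype.sum_prod_type]
      refine Finset.sum_congr rfl fun i _ => ?_
      simp only [tensor, Fin.sum_univ_two, Matrix.cons_val_zero, Matrix.cons_val_one, ← mul_sub,
        abs_mul, abs_of_nonneg (hp.1 i)]
      rw [show 1 - δ - 1 = -δ by ring, abs_neg, sub_zero, abs_of_pos hδ0]
      ring
    rw [hsum, ← Finset.sum_mul, hp.2]
    linarith
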